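/- arXiv:1102.2593 — 2 statements merged into one kernel-verified Lean document; each statement's English description precedes it below -/
import Mathlib

section
/- Let q be a prime power, let n, k, δ be integers with 1 < k ≤ n−k and 1 ≤ δ ≤ k, let 𝒞 be a [k×(n−k), (n−k)(k−δ+1), δ]_q MRD code, and let C^MRD be its lifted code. Then each one-dimensional subspace X ∈ V^n (i.e., each one-dimensional subspace of 𝔽_q^n spanned by a vector of L^{(n,k)}) is contained in exactly q^{(n−k)(k−δ)} codewords of C^MRD. -/
open Module Polynomial Matrix

variable (F : Type) [Field F] [Fintype F]

/-- `C` is a `[k × (n-k), (n-k)(k-δ+1), δ]_q` MRD (maximum rank distance) code: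
an `F`-linear subspace of `k × (n-k)` matrices of dimension `(n-k)(k-δ+1)` in which
every nonzero matrix has rank at least `δ`. -/
def IsMRD (n k δ : ℕ) (C : Submodule F (Matrix (Fin k) (Fin (n - k)) F)) : Prop :=
  Module.finrank F C = (n - k) * (k - δ + 1) ∧
    ∀ A : Matrix (Fin k) (Fin (n - k)) F, A ∈ C → A ≠ 0 → δ ≤ A.rank

/-- The matrix `[I_k | A]`. -/
def liftMatrix (n k : ℕ) (A : Matrix (Fin k) (Fin (n - k)) F) : Matrix (Fin k) (Fin n) F :=
  Matrix.of fun i j =>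
    if h : (j : ℕ) < k then (if (i : ℕ) = (j : ℕ) then 1 else 0)
    else A i ⟨(j : ℕ) - k, by have := j.isLt; omega⟩

/-- The lifting of the matrix `A`: the row space of `[I_k | A]`, a subspace of `F^n`. -/
def liftSubspace (n k : ℕ) (A : Matrix (Fin k) (Fin (n - k)) F) : Submodule F (Fin n → F) :=
  Submodule.span F (Set.range fun i => liftMatrix F n k A i)

/-- The lifted code of a rank-metric code `C`: the set of liftings of all codewords of `C`. -/
def liftedCode (n k : ℕ) (C : Submodule F (Matrix (Fin k) (Fin (n - k)) F)) :
    Set (Submodule F (Fin n → F)) :=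
  {X | ∃ A ∈ C, X = liftSubspace F n k A}

/-- The subspace distance `d_S(X,Y) = dim X + dim Y - 2 dim (X ⊓ Y)`. -/
noncomputable def subDist {n : ℕ} (X Y : Submodule F (Fin n → F)) : ℕ :=
  finrank F X + finrank F Y - 2 * finrank F (X ⊓ Y : Submodule F (Fin n → F))

/-- `L^{(n,k)}`: vectors of `F^n` whose first `k` coordinates are not all zero. -/
def Lset (n k : ℕ) : Set (Fin n → F) := {v | ∃ i : Fin n, (i : ℕ) < k ∧ v i ≠ 0}

/-- `V^n`: one-dimensional subspaces of `F^n` spanned by vectors of `L^{(n,k)}`. -/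
def Vset (n k : ℕ) : Set (Submodule F (Fin n → F)) :=
  {X | ∃ v ∈ Lset F n k, X = Submodule.span F {v}}

/-- Projection of a vector of `F^n` onto its first `k` coordinates. -/
def projK (n k : ℕ) (v : Fin n → F) : Fin k → F :=
  fun i => if h : (i : ℕ) < n then v ⟨(i : ℕ), h⟩ else 0

/-- `V_A^{(n,k)}`: one-dimensional subspaces of `F^n` spanned by vectors whose projection
onto the first `k` coordinates is a nonzero vector spanning `A`. -/
def VA (n k : ℕ) (A : Submodule F (Fin k → F)) : Set (Submodule F (Fin n → F)) :=
  {X | ∃ v : Fin n → F, projK F n k v ≠ 0 ∧ Submodule.span F {projK F n k v} = A ∧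
    X = Submodule.span F {v}}

/-- `A_q(n,d,k)`: the maximum size of an `(n, M, d, k)_q` constant dimension code, i.e. of a
set of `k`-dimensional subspaces of `F^n` whose pairwise subspace distances are at least `d`. -/
noncomputable def Aq (n d k : ℕ) : ℕ :=
  sSup {M | ∃ S : Set (Submodule F (Fin n → F)), S.Finite ∧ S.ncard = M ∧
    (∀ X ∈ S, finrank F X = k) ∧ ∀ X ∈ S, ∀ Y ∈ S, X ≠ Y → d ≤ subDist F X Y}

/-- The Gaussian coefficient `[n, k]_q`: the number of `k`-dimensional subspaces of `F^n`. -/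
noncomputable def gaussNat (n k : ℕ) : ℕ :=
  Nat.card {X : Submodule F (Fin n → F) // finrank F X = k}

section

variable {K V : Type*} [Field K] [AddCommGroup V] [Module K V] [FiniteDimensional K V]

/-- Any subspace is contained in a subspace of any prescribed larger dimension. -/
lemma exists_le_submodule_finrank_eq (N : Submodule K V) {d : ℕ} (hd : finrank K N ≤ d) :
    d ≤ finrank K V → ∃ W : Submodule K V, N ≤ W ∧ finrank K W = d := by
  induction d, hd using Nat.le_induction with
  | base => exact fun _ => ⟨N, le_rfl, rfl⟩
  | succ d _ ih =>
    intro h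
    obtain ⟨W, hNW, hW⟩ := ih (by omega)
    obtain ⟨x, hx⟩ : ∃ x, x ∉ W := by
      by_contra! hall
      rw [(Submodule.eq_top_iff').2 hall, finrank_top] at hW
      omega
    refine ⟨W ⊔ Submodule.span K {x}, hNW.trans le_sup_left, ?_⟩
    rw [Submodule.finrank_sup_span_singleton hx, hW]

end

section

variable {K m l : Type*} [Field K] [Fintype m] [Fintype l]

/-- A subspace of the left kernel of a matrix has complementary dimension at least the rank. -/
lemma finrank_add_rank_le_of_vecMul_eq_zero (A : Matrix m l K) (W : Submodule K (m → K))
    (hW : ∀ x ∈ W, x ᵥ* A = 0) : finrank K W + A.rank ≤ Fintype.card m := by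
  have hker : W ≤ LinearMap.ker Aᵀ.mulVecLin := fun x hx => by
    simpa [Matrix.mulVec_transpose] using hW x hx
  have h := LinearMap.finrank_range_add_finrank_ker Aᵀ.mulVecLin
  have hle := Submodule.finrank_mono hker
  rw [← Matrix.rank_transpose, Matrix.rank, ← finrank_fintype_fun_eq_card (R := K)]
  omega

/-- In a matrix code attaining the Singleton bound, left multiplication of the codewords by a
fixed nonzero vector is surjective. -/
lemma exists_mem_vecMul_eq {C : Submodule K (Matrix m l K)} {δ : ℕ}
    (hδ1 : 1 ≤ δ) (hδ : δ ≤ Fintype.card m)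
    (hdim : finrank K C = Fintype.card l * (Fintype.card m - δ + 1))
    (hrank : ∀ A ∈ C, A ≠ 0 → δ ≤ A.rank) {u : m → K} (hu : u ≠ 0) (w : l → K) :
    ∃ A ∈ C, u ᵥ* A = w := by
  obtain ⟨W, huW, hW⟩ := exists_le_submodule_finrank_eq (Submodule.span K {u})
    (d := Fintype.card m - δ + 1) (by rw [finrank_span_singleton hu]; omega)
    (by rw [finrank_fintype_fun_eq_card]; omega)
  have hu' : u ∈ W := huW (Submodule.mem_span_singleton_self u)
  let φ : C →ₗ[K] W →ₗ[K] (l → K) :=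
    LinearMap.mk₂ K (fun A x => (x : m → K) ᵥ* (A : Matrix m l K))
      (fun _ _ _ => by simp [Matrix.vecMul_add]) (fun _ _ _ => by simp [Matrix.vecMul_smul])
      (fun _ _ _ => by simp [Matrix.add_vecMul]) (fun _ _ _ => by simp [Matrix.smul_vecMul])
  have hinj : Function.Injective φ := by
    refine (injective_iff_map_eq_zero φ).2 fun A hA => ?_
    by_contra hA0
    have h1 := hrank A A.2 (by simpa using hA0)
    have h2 := finrank_add_rank_le_of_vecMul_eq_zero (A : Matrix m l K) W fun x hx =>
      LinearMap.congr_fun hA ⟨x, hx⟩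
    omega
  have hsurj : Function.Surjective φ :=
    (LinearMap.injective_iff_surjective_of_finrank_eq_finrank (by
      rw [hdim, Module.finrank_linearMap, hW, finrank_fintype_fun_eq_card, mul_comm])).1 hinj
  obtain ⟨f, hf⟩ := Module.Projective.exists_dual_eq_one K (x := (⟨u, hu'⟩ : W))
    (by simpa [Subtype.ext_iff] using hu)
  obtain ⟨A, hA⟩ := hsurj (f.smulRight w)
  refine ⟨A, A.2, ?_⟩
  have := LinearMap.congr_fun hA ⟨u, hu'⟩
  simpa [φ, hf] using this

/-- In a matrix code attaining the Singleton bound, the codewords sending a fixed nonzero vector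
to a prescribed vector form a fibre of the size of a code with one row fewer. -/
lemma ncard_vecMul_eq [Fintype K] {C : Submodule K (Matrix m l K)} {δ : ℕ}
    (hδ1 : 1 ≤ δ) (hδ : δ ≤ Fintype.card m)
    (hdim : finrank K C = Fintype.card l * (Fintype.card m - δ + 1))
    (hrank : ∀ A ∈ C, A ≠ 0 → δ ≤ A.rank) {u : m → K} (hu : u ≠ 0) (w : l → K) :
    {A ∈ (C : Set (Matrix m l K)) | u ᵥ* A = w}.ncard =
      Fintype.card K ^ (Fintype.card l * (Fintype.card m - δ)) := by
  let ψ : C →ₗ[K] (l → K) :=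
    { toFun := fun A => u ᵥ* (A : Matrix m l K)
      map_add' := fun _ _ => by simp [Matrix.vecMul_add]
      map_smul' := fun _ _ => by simp [Matrix.vecMul_smul] }
  have hψ : LinearMap.range ψ = ⊤ := LinearMap.range_eq_top.2 fun w => by
    obtain ⟨A, hA, h⟩ := exists_mem_vecMul_eq hδ1 hδ hdim hrank hu w
    exact ⟨⟨A, hA⟩, h⟩
  have hker : finrank K (LinearMap.ker ψ) = Fintype.card l * (Fintype.card m - δ) := by
    have h := LinearMap.finrank_range_add_finrank_ker ψ
    rw [hψ, finrank_top, finrank_fintype_fun_eq_card, hdim, mul_add_one] at h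
    omega
  obtain ⟨B, hB, hBw⟩ := exists_mem_vecMul_eq hδ1 hδ hdim hrank hu w
  have himage : {A ∈ (C : Set (Matrix m l K)) | u ᵥ* A = w} =
      Set.range fun A : LinearMap.ker ψ => ((A : C) : Matrix m l K) + B := by
    ext A
    constructor
    · rintro ⟨hA, hAw⟩
      refine ⟨⟨⟨A - B, C.sub_mem hA hB⟩, ?_⟩, by simp⟩
      simp [ψ, Matrix.vecMul_sub, hAw, hBw]
    · rintro ⟨D, rfl⟩
      have hD : u ᵥ* ((D : C) : Matrix m l K) = 0 := D.2
      exact ⟨C.add_mem D.1.2 hB, by simp [Matrix.vecMul_add, hD, hBw]⟩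
  have hinj : Function.Injective fun A : LinearMap.ker ψ => ((A : C) : Matrix m l K) + B :=
    fun _ _ h => Subtype.ext (Subtype.ext (add_right_cancel h))
  rw [himage, ← Set.image_univ, Set.ncard_image_of_injective _ hinj, Set.ncard_univ,
    Module.natCard_eq_pow_finrank (K := K), hker, Nat.card_eq_fintype_card]

end

section

variable {K : Type} [Field K]

/-- Membership in the lifting of `A`, read off from the two blocks of coordinates. -/
lemma mem_liftSubspace_iff {n k : ℕ} (hkn : k ≤ n) (A : Matrix (Fin k) (Fin (n - k)) K)
    (v : Fin n → K) :
    v ∈ liftSubspace K n k A ↔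
      projK K n k v ᵥ* A = fun j : Fin (n - k) => v ⟨k + j, by omega⟩ := by
  have hmem : v ∈ liftSubspace K n k A ↔ ∃ c : Fin k → K, c ᵥ* liftMatrix K n k A = v := by
    rw [liftSubspace, Submodule.mem_span_range_iff_exists_fun]
    refine exists_congr fun c => ?_
    rw [Matrix.vecMul_eq_sum]
  have hleft (c : Fin k → K) (i : Fin k) :
      (c ᵥ* liftMatrix K n k A) ⟨i, by omega⟩ = c i := by
    simp [Matrix.vecMul, dotProduct, liftMatrix, Fin.val_inj]
  have hright (c : Fin k → K) (j : Fin (n - k)) :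
      (c ᵥ* liftMatrix K n k A) ⟨k + j, by omega⟩ = (c ᵥ* A) j := by
    simp [Matrix.vecMul, dotProduct, liftMatrix]
  have hproj (i : Fin k) : projK K n k v i = v ⟨i, by omega⟩ := dif_pos _
  rw [hmem]
  constructor
  · rintro ⟨c, rfl⟩
    have hc : projK K n k (c ᵥ* liftMatrix K n k A) = c := by
      ext i
      rw [projK, dif_pos (by omega), hleft]
    rw [hc]
    ext j
    rw [hright]
  · intro h
    refine ⟨projK K n k v, funext fun j => ?_⟩
    by_cases hj : (j : ℕ) < k
    · exact (hleft _ ⟨j, hj⟩).trans (hproj ⟨j, hj⟩)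
    · have hj' : j = ⟨k + ((⟨j - k, by omega⟩ : Fin (n - k)) : ℕ), by simp; omega⟩ :=
        Fin.ext (by simp; omega)
      rw [hj', hright, h]

/-- A matrix is determined by its lifting. -/
lemma liftSubspace_injective {n k : ℕ} (hkn : k ≤ n) :
    Function.Injective (liftSubspace K n k) := by
  intro A B hAB
  ext i j
  have hrow : liftMatrix K n k A i ∈ liftSubspace K n k B :=
    hAB ▸ Submodule.subset_span ⟨i, rfl⟩
  have hproj : projK K n k (liftMatrix K n k A i) = Pi.single i 1 := by
    ext a
    rw [projK, dif_pos (by omega)]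
    simp [liftMatrix, Pi.single_apply, Fin.val_inj, eq_comm]
  have h := congrFun ((mem_liftSubspace_iff hkn B _).1 hrow) j
  rw [hproj, Matrix.single_one_vecMul] at h
  simpa [liftMatrix] using h.symm

end

/-- Each one-dimensional subspace `X ∈ V^n` is contained in exactly
`q^{(n-k)(k-δ)}` codewords of the lifted MRD code. -/
theorem stmt5 (q n k δ : ℕ) (hq : Fintype.card F = q)
    (hk : 1 < k) (hkn : k ≤ n - k) (hδ1 : 1 ≤ δ) (hδk : δ ≤ k)
    (C : Submodule F (Matrix (Fin k) (Fin (n - k)) F)) (hC : IsMRD F n k δ C) :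
    ∀ X ∈ Vset F n k,
      {Y ∈ liftedCode F n k C | X ≤ Y}.ncard = q ^ ((n - k) * (k - δ)) := by
  rintro _ ⟨v, ⟨i, hik, hvi⟩, rfl⟩
  have hu : projK F n k v ≠ 0 := fun h0 => hvi <| by
    simpa [projK] using congrFun h0 ⟨i, hik⟩
  have hcodewords : {Y ∈ liftedCode F n k C | Submodule.span F {v} ≤ Y} =
      liftSubspace F n k '' {A ∈ (C : Set (Matrix (Fin k) (Fin (n - k)) F)) |
        projK F n k v ᵥ* A = fun j : Fin (n - k) => v ⟨k + j, by omega⟩} := by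
    ext Y
    simp only [Submodule.span_singleton_le_iff_mem]
    constructor
    · rintro ⟨⟨A, hA, rfl⟩, hv⟩
      exact ⟨A, ⟨hA, (mem_liftSubspace_iff (by omega) A v).1 hv⟩, rfl⟩
    · rintro ⟨A, ⟨hA, hv⟩, rfl⟩
      exact ⟨⟨A, hA, rfl⟩, (mem_liftSubspace_iff (by omega) A v).2 hv⟩
  have hcard := ncard_vecMul_eq (C := C) hδ1 (by simpa using hδk) (by simpa using hC.1) hC.2 hu
    (fun j : Fin (n - k) => v ⟨k + j, by omega⟩)
  rw [hcodewords, Set.ncard_image_of_injective _ (liftSubspace_injective (by omega)), hcard,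
    Fintype.card_fin, Fintype.card_fin, hq]
end

section
/- Let q be a prime power and let n, k be integers with 1 < 2k ≤ n−2k (so n ≥ 4k). If ℂ is an (n,M,2k,2k)_q constant dimension code which contains an (n,2k,k)_q lifted MRD code C^MRD as a subcode, then M ≤ q^{(n−2k)(k+1)} + Gauss[n−2k, k]_q · (q^n − q^{n−2k})/(q^{2k} − q^k) + A_q(n−2k, 2k, 2k). -/
open Module Polynomial Matrix

variable (F : Type) [Field F] [Fintype F]

section RankMetric

variable {F} {K : Type*} [Field K]

theorem exists_mem_mul_eq {N m s δ : ℕ} (hs : s + δ = N + 1)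
    (C : Submodule K (Matrix (Fin N) (Fin m) K)) (hC : finrank K C = m * s)
    (hrank : ∀ A ∈ C, A ≠ 0 → δ ≤ A.rank)
    (B : Matrix (Fin s) (Fin N) K) (hB : LinearIndependent K B.row)
    (D : Matrix (Fin s) (Fin m) K) : ∃ A ∈ C, B * A = D := by
  let f : C →ₗ[K] Matrix (Fin s) (Fin m) K :=
    { toFun := fun A => B * (A : Matrix (Fin N) (Fin m) K)
      map_add' := fun X Y => by simp [Matrix.mul_add]
      map_smul' := fun c X => by simp }
  have hf : Function.Injective f := by
    rw [injective_iff_map_eq_zero]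
    intro A hA
    by_contra hne
    have h₁ := hrank A A.2 (by simpa using hne)
    have h₂ := Matrix.rank_add_rank_le_card_of_mul_eq_zero (show B * A.1 = 0 from hA)
    rw [hB.rank_matrix] at h₂
    simp only [Fintype.card_fin] at h₂
    omega
  have hdim : finrank K C = finrank K (Matrix (Fin s) (Fin m) K) := by
    rw [hC, Module.finrank_matrix]; simp [mul_comm]
  obtain ⟨A, hA⟩ := (LinearMap.injective_iff_surjective_of_finrank_eq_finrank hdim).1 hf D
  exact ⟨A, A.2, hA⟩

variable (K) in
/-- The projection of `K ^ n` onto its first `k` coordinates, as a linear map. -/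
def headProj (n k : ℕ) (h : k ≤ n) : (Fin n → K) →ₗ[K] (Fin k → K) :=
  LinearMap.funLeft K K (Fin.castLE h)

theorem headProj_surjective {n k : ℕ} (h : k ≤ n) : Function.Surjective (headProj K n k h) :=
  LinearMap.funLeft_surjective_of_injective K K _ (Fin.castLE_injective h)

theorem finrank_ker_headProj {n k : ℕ} (h : k ≤ n) :
    finrank K (LinearMap.ker (headProj K n k h)) = n - k := by
  have := LinearMap.finrank_range_add_finrank_ker (headProj K n k h)
  rw [LinearMap.range_eq_top.2 (headProj_surjective h)] at this
  simp at this
  omega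

theorem mem_liftSubspace {K : Type} [Field K] {n k : ℕ} (h : k ≤ n)
    (A : Matrix (Fin k) (Fin (n - k)) K) (v : Fin n → K)
    (hv : ∀ j, (headProj K n k h v ᵥ* A) j = v ⟨k + j, by omega⟩) :
    v ∈ liftSubspace K n k A := by
  have : v = ∑ i, headProj K n k h v i • liftMatrix K n k A i := by
    ext j
    simp only [Finset.sum_apply, Pi.smul_apply, smul_eq_mul, liftMatrix, Matrix.of_apply]
    by_cases hj : (j : ℕ) < k
    · rw [Finset.sum_eq_single ⟨j, hj⟩]
      · simp [hj, headProj, LinearMap.funLeft_apply]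
      · intro b _ hb
        have hbj : (b : ℕ) ≠ j := fun h => hb (Fin.ext h)
        simp [hj, hbj]
      · simp
    · have := hv ⟨j - k, by omega⟩
      simp only [hj, dite_false]
      rw [Matrix.vecMul, dotProduct] at this
      rw [this]
      congr 1
      ext
      simp; omega
  rw [this]
  exact Submodule.sum_mem _ fun i _ => Submodule.smul_mem _ _ (Submodule.subset_span ⟨i, rfl⟩)

theorem exists_le_finrank_inf_liftSubspace {K : Type} [Field K] {n N s δ : ℕ} (hN : N ≤ n)
    (hs : s + δ = N + 1)
    (C : Submodule K (Matrix (Fin N) (Fin (n - N)) K)) (hC : finrank K C = (n - N) * s)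
    (hrank : ∀ A ∈ C, A ≠ 0 → δ ≤ A.rank) (X : Submodule K (Fin n → K))
    (hX : s ≤ finrank K (X.map (headProj K n N hN))) :
    ∃ A ∈ C, s ≤ finrank K (X ⊓ liftSubspace K n N A : Submodule K (Fin n → K)) := by
  obtain ⟨w, hw⟩ := exists_linearIndependent_of_le_finrank hX
  choose x hxX hxw using fun i => Submodule.mem_map.1 (w i).2
  have hw' : LinearIndependent K fun i => headProj K n N hN (x i) := by
    simp only [hxw]
    exact hw.map' (Submodule.subtype _) (Submodule.ker_subtype _)
  have hx : LinearIndependent K x := hw'.of_comp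
  obtain ⟨A, hA, hAD⟩ := exists_mem_mul_eq hs C hC hrank
    (Matrix.of fun i => headProj K n N hN (x i)) hw'
    (Matrix.of fun i j => x i ⟨N + j, by omega⟩)
  refine ⟨A, hA, ?_⟩
  have hmem : ∀ i, x i ∈ X ⊓ liftSubspace K n N A := fun i =>
    ⟨hxX i, mem_liftSubspace hN A _ fun j => congrFun (congrFun hAD i) j⟩
  have hspan := finrank_span_eq_card hx
  rw [Fintype.card_fin] at hspan
  rw [← hspan]
  exact Submodule.finrank_mono (Submodule.span_le.2 (by rintro _ ⟨i, rfl⟩; exact hmem i))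

theorem finrank_map_add_finrank_inf_ker {V W : Type*} [AddCommGroup V] [Module K V]
    [FiniteDimensional K V] [AddCommGroup W] [Module K W] (f : V →ₗ[K] W) (X : Submodule K V) :
    finrank K (X.map f) + finrank K (X ⊓ LinearMap.ker f : Submodule K V) = finrank K X := by
  have h := LinearMap.finrank_range_add_finrank_ker (f.domRestrict X)
  rw [LinearMap.range_domRestrict, LinearMap.ker_domRestrict] at h
  rw [← h, ← Submodule.map_comap_subtype, Submodule.finrank_map_subtype_eq]

theorem ncard_liftedCode_le {n k : ℕ} (C : Submodule F (Matrix (Fin k) (Fin (n - k)) F)) :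
    (liftedCode F n k C).ncard ≤ Fintype.card F ^ finrank F C := by
  have h : liftedCode F n k C = liftSubspace F n k '' (C : Set _) := by
    ext X
    simp [liftedCode, eq_comm]
  rw [h, ← Nat.card_eq_fintype_card, ← Module.natCard_eq_pow_finrank (K := F) (V := C)]
  exact Set.ncard_image_le (Set.toFinite _)

theorem ncard_le_Aq {n d k : ℕ} (S : Set (Submodule F (Fin n → F)))
    (hdim : ∀ X ∈ S, finrank F X = k) (hdist : ∀ X ∈ S, ∀ Y ∈ S, X ≠ Y → d ≤ subDist F X Y) :
    S.ncard ≤ Aq F n d k := by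
  refine le_csSup ⟨Nat.card (Submodule F (Fin n → F)), ?_⟩ ⟨S, S.toFinite, rfl, hdim, hdist⟩
  rintro _ ⟨T, -, rfl, -⟩
  exact Set.ncard_le_card T

theorem finrank_comap_of_le_range {V W : Type*} [AddCommGroup V] [Module K V]
    [AddCommGroup W] [Module K W] {e : V →ₗ[K] W} (he : Function.Injective e)
    {X : Submodule K W} (hX : X ≤ LinearMap.range e) :
    finrank K (X.comap e) = finrank K X := by
  rw [(Submodule.equivMapOfInjective e he _).finrank_eq, Submodule.map_comap_eq_of_le hX]

theorem ncard_le_Aq_of_le_range {n m d k : ℕ} {e : (Fin m → F) →ₗ[F] (Fin n → F)}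
    (he : Function.Injective e) (S : Set (Submodule F (Fin n → F)))
    (hS : ∀ X ∈ S, X ≤ LinearMap.range e)
    (hdim : ∀ X ∈ S, finrank F X = k) (hdist : ∀ X ∈ S, ∀ Y ∈ S, X ≠ Y → d ≤ subDist F X Y) :
    S.ncard ≤ Aq F m d k := by
  have hinj : Set.InjOn (Submodule.comap e) S := fun X hX Y hY h => by
    rw [← Submodule.map_comap_eq_of_le (hS X hX), h, Submodule.map_comap_eq_of_le (hS Y hY)]
  rw [← hinj.ncard_image]
  refine ncard_le_Aq _ ?_ ?_
  · rintro _ ⟨X, hX, rfl⟩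
    rw [finrank_comap_of_le_range he (hS X hX), hdim X hX]
  · rintro _ ⟨X, hX, rfl⟩ _ ⟨Y, hY, rfl⟩ hne
    have := hdist X hX Y hY fun h => hne (h ▸ rfl)
    rw [subDist, ← Submodule.comap_inf, finrank_comap_of_le_range he (hS X hX),
      finrank_comap_of_le_range he (hS Y hY),
      finrank_comap_of_le_range he (inf_le_left.trans (hS X hX))]
    exact this

theorem exists_ne_finrank_eq_of_lt {V : Type*} [AddCommGroup V] [Module K V]
    {k : ℕ} (hk : 0 < k) {Y : Submodule K V} (hY : k < finrank K Y) :
    ∃ U₁ ≤ Y, ∃ U₂ ≤ Y, U₁ ≠ U₂ ∧ finrank K U₁ = k ∧ finrank K U₂ = k := by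
  obtain ⟨v, hv⟩ := exists_linearIndependent_of_le_finrank (Nat.succ_le_of_lt hY)
  replace hv : LinearIndependent K fun i => (v i : V) :=
    hv.map' Y.subtype (Submodule.ker_subtype _)
  have hspan (f : Fin k → Fin (k + 1)) (hf : Function.Injective f) :
      Submodule.span K (Set.range fun i => (v (f i) : V)) ≤ Y ∧
        finrank K (Submodule.span K (Set.range fun i => (v (f i) : V))) = k := by
    constructor
    · rw [Submodule.span_le]
      rintro _ ⟨i, rfl⟩
      exact (v (f i)).2
    · simpa [Function.comp_def] using finrank_span_eq_card (hv.comp f hf)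
  obtain ⟨h₁, hr₁⟩ := hspan _ (Fin.castSucc_injective k)
  obtain ⟨h₂, hr₂⟩ := hspan _ (Fin.succ_injective k)
  refine ⟨_, h₁, _, h₂, fun h => ?_, hr₁, hr₂⟩
  have hmem : (v (Fin.castSucc ⟨0, hk⟩) : V) ∈
      Submodule.span K (Set.range fun i : Fin k => (v i.castSucc : V)) :=
    Submodule.subset_span ⟨_, rfl⟩
  rw [h, show (Set.range fun i : Fin k => (v i.succ : V)) =
    (fun i => (v i : V)) '' Set.range Fin.succ from
      Set.range_comp (fun i => (v i : V)) Fin.succ] at hmem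
  exact hv.notMem_span_image (by simp) hmem

theorem card_filter_mem_and_notMem {V : Type*} [AddCommGroup V] [Module F V] [Fintype V]
    [DecidableEq V] (A B : Submodule F V) [DecidablePred (· ∈ A)] [DecidablePred (· ∈ B)] :
    (Finset.univ.filter fun v => v ∈ A ∧ v ∉ B).card =
      Fintype.card F ^ finrank F A - Fintype.card F ^ finrank F (A ⊓ B : Submodule F V) := by
  classical
  have hcard (X : Submodule F V) :
      Fintype.card F ^ finrank F X = (Finset.univ.filter (· ∈ X)).card := by
    rw [← Fintype.card_subtype, ← Module.card_eq_pow_finrank (K := F) (V := X)]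
  rw [hcard, hcard, ← Finset.card_sdiff_of_subset]
  · congr 1
    ext v
    simp
    tauto
  · intro v
    simp +contextual

theorem finrank_map_of_injective {V W : Type*} [AddCommGroup V] [Module K V]
    [AddCommGroup W] [Module K W] {e : V →ₗ[K] W} (he : Function.Injective e)
    (U : Submodule K V) : finrank K (U.map e) = finrank K U :=
  (Submodule.equivMapOfInjective e he U).finrank_eq.symm

theorem pow_sub_pow_le_sum {V : Type*} [AddCommGroup V] [Module F V] [Finite V] {k : ℕ}
    {Y : Submodule F V} (T : Finset (Submodule F V)) (hT : ∀ U, U ∈ T ↔ finrank F U = k ∧ U ≤ Y)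
    (hkY : k ≤ finrank F Y) (hY : finrank F Y < 2 * k) :
    Fintype.card F ^ (2 * k) - Fintype.card F ^ k ≤
      ∑ _U ∈ T, (Fintype.card F ^ (2 * k) - Fintype.card F ^ finrank F Y) := by
  rw [Finset.sum_const, smul_eq_mul]
  rcases hkY.eq_or_lt with h | h
  · rw [← h]
    exact Nat.le_mul_of_pos_left _ (Finset.card_pos.2 ⟨Y, (hT Y).2 ⟨h.symm, le_rfl⟩⟩)
  · obtain ⟨U₁, h₁, U₂, h₂, hne, hr₁, hr₂⟩ := exists_ne_finrank_eq_of_lt (by omega) h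
    have hcard : 2 ≤ T.card :=
      Finset.one_lt_card.2 ⟨U₁, (hT _).2 ⟨hr₁, h₁⟩, U₂, (hT _).2 ⟨hr₂, h₂⟩, hne⟩
    have hpow : 2 * Fintype.card F ^ finrank F Y ≤ Fintype.card F ^ (2 * k) :=
      calc 2 * Fintype.card F ^ finrank F Y
          ≤ Fintype.card F ^ (finrank F Y + 1) := by
            rw [pow_succ']
            exact Nat.mul_le_mul_right _ (Fintype.one_lt_card (α := F))
        _ ≤ _ := Nat.pow_le_pow_right Fintype.card_pos hY
    calc _ ≤ Fintype.card F ^ (2 * k) := Nat.sub_le _ _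
      _ ≤ 2 * (Fintype.card F ^ (2 * k) - Fintype.card F ^ finrank F Y) := by omega
      _ ≤ _ := Nat.mul_le_mul_right _ hcard

theorem card_mul_le_of_finrank_inf_le {V W : Type*} [AddCommGroup V] [Module F V] [Finite V]
    [AddCommGroup W] [Module F W] [Finite W] {e : W →ₗ[F] V} (he : Function.Injective e) {k : ℕ}
    (P : Finset (Submodule F V)) (hP : ∀ X ∈ P, finrank F X = 2 * k)
    (hle : ∀ X ∈ P, k ≤ finrank F (X.comap e)) (hlt : ∀ X ∈ P, finrank F (X.comap e) < 2 * k)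
    (hinf : ∀ X ∈ P, ∀ Y ∈ P, X ≠ Y → finrank F (X ⊓ Y : Submodule F V) ≤ k) :
    P.card * (Fintype.card F ^ (2 * k) - Fintype.card F ^ k) ≤
      Nat.card {U : Submodule F W // finrank F U = k} *
        (Fintype.card F ^ finrank F V - Fintype.card F ^ finrank F W) := by
  classical
  have := Fintype.ofFinite V
  have := Fintype.ofFinite (Submodule F W)
  let T : Finset (Submodule F W) := Finset.univ.filter fun U => finrank F U = k
  let out (X : Submodule F V) : Finset V :=
    Finset.univ.filter fun v => v ∈ X ∧ v ∉ LinearMap.range e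
  have hout (X : Submodule F V) : (out X).card =
      Fintype.card F ^ finrank F X - Fintype.card F ^ finrank F (X.comap e) := by
    rw [card_filter_mem_and_notMem, ← finrank_map_of_injective he, Submodule.map_comap_eq,
      inf_comm]
  have hpair (U) (hU : U ∈ T) :
      ∑ X ∈ P.filter (fun X => U ≤ X.comap e), (out X).card ≤
        Fintype.card F ^ finrank F V - Fintype.card F ^ finrank F W := by
    rw [← Finset.card_biUnion]
    · have htop := hout ⊤
      rw [finrank_top, Submodule.comap_top, finrank_top] at htop
      rw [← htop]
      refine Finset.card_le_card (Finset.biUnion_subset.2 fun X _ v hv => ?_)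
      simp only [out, Finset.mem_filter, Submodule.mem_top] at hv ⊢
      tauto
    · intro X hX Y hY hne
      simp only [Finset.coe_filter, Set.mem_ofPred_eq] at hX hY
      have hUle : U.map e ≤ X ⊓ Y :=
        le_inf (Submodule.map_le_iff_le_comap.2 hX.2) (Submodule.map_le_iff_le_comap.2 hY.2)
      have hEq : U.map e = X ⊓ Y := by
        refine Submodule.eq_of_le_of_finrank_le hUle ?_
        rw [finrank_map_of_injective he, (Finset.mem_filter.1 hU).2]
        exact hinf X hX.1 Y hY.1 hne
      refine Finset.disjoint_left.2 fun v hvX hvY => ?_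
      simp only [out, Finset.mem_filter] at hvX hvY
      exact hvX.2.2 (LinearMap.map_le_range (hEq ▸ ⟨hvX.2.1, hvY.2.1⟩ : v ∈ U.map e))
  calc P.card * (Fintype.card F ^ (2 * k) - Fintype.card F ^ k)
      = ∑ X ∈ P, (Fintype.card F ^ (2 * k) - Fintype.card F ^ k) := by simp
    _ ≤ ∑ X ∈ P, ∑ U ∈ T.filter (· ≤ X.comap e), (out X).card := by
        refine Finset.sum_le_sum fun X hX => ?_
        rw [hout, hP X hX]
        exact pow_sub_pow_le_sum _ (by simp [T]) (hle X hX) (hlt X hX)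
    _ = ∑ U ∈ T, ∑ X ∈ P.filter (fun X => U ≤ X.comap e), (out X).card :=
        Finset.sum_comm' (by simp; tauto)
    _ ≤ ∑ U ∈ T, (Fintype.card F ^ finrank F V - Fintype.card F ^ finrank F W) :=
        Finset.sum_le_sum hpair
    _ = _ := by
        rw [Finset.sum_const, smul_eq_mul, Nat.card_eq_fintype_card, Fintype.card_subtype]

theorem pow_sub_pow_dvd_pow_sub_pow {q n k : ℕ} (h : 4 * k ≤ n) :
    q ^ (2 * k) - q ^ k ∣ q ^ n - q ^ (n - 2 * k) := by
  refine ⟨q ^ (n - 3 * k) * (q ^ k + 1), ?_⟩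
  have h₁ : q ^ n = q ^ (n - 3 * k) * q ^ (3 * k) := by rw [← pow_add]; congr 1; omega
  have h₂ : q ^ (n - 2 * k) = q ^ (n - 3 * k) * q ^ k := by rw [← pow_add]; congr 1; omega
  rw [h₁, h₂, ← Nat.mul_sub, mul_left_comm, Nat.sub_mul]
  congr 1
  have h₃ : q ^ (3 * k) = q ^ (2 * k) * q ^ k := by rw [← pow_add]; congr 1; omega
  have h₄ : q ^ (2 * k) = q ^ k * q ^ k := by rw [← pow_add]; congr 1; omega
  rw [h₃, mul_add, mul_add, ← h₄, mul_one, mul_one, Nat.add_comm (q ^ (2 * k)) (q ^ k),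
    Nat.add_sub_add_right]

end RankMetric

/-- If an `(n, M, 2k, 2k)_q` constant dimension code contains an
`(n,2k,k)_q` lifted MRD code, then
`M ≤ q^{(n-2k)(k+1)} + Gauss[n-2k,k]_q (q^n - q^{n-2k})/(q^{2k} - q^k) + A_q(n-2k, 2k, 2k)`. -/
theorem stmt11 (q n k : ℕ) (hq : Fintype.card F = q)
    (hk : 1 < 2 * k) (hkn : 2 * k ≤ n - 2 * k)
    (C : Submodule F (Matrix (Fin (2 * k)) (Fin (n - 2 * k)) F)) (hC : IsMRD F n (2 * k) k C)
    (S : Set (Submodule F (Fin n → F))) (hfin : S.Finite)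
    (hsub : liftedCode F n (2 * k) C ⊆ S)
    (hdim : ∀ X ∈ S, finrank F X = 2 * k)
    (hdist : ∀ X ∈ S, ∀ Y ∈ S, X ≠ Y → 2 * k ≤ subDist F X Y) :
    S.ncard ≤ q ^ ((n - 2 * k) * (k + 1)) +
      gaussNat F (n - 2 * k) k * ((q ^ n - q ^ (n - 2 * k)) / (q ^ (2 * k) - q ^ k)) +
      Aq F (n - 2 * k) (2 * k) (2 * k) := by
  subst hq
  have hn : 2 * k ≤ n := by omega
  let p := headProj F n (2 * k) hn
  have hker : finrank F (LinearMap.ker p) = n - 2 * k := finrank_ker_headProj hn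
  let g : (Fin (n - 2 * k) → F) ≃ₗ[F] LinearMap.ker p :=
    LinearEquiv.ofFinrankEq _ _ (by rw [hker, Module.finrank_fin_fun])
  let e : (Fin (n - 2 * k) → F) →ₗ[F] (Fin n → F) := (LinearMap.ker p).subtype ∘ₗ g.toLinearMap
  have he : Function.Injective e := (LinearMap.ker p).injective_subtype.comp g.injective
  have hrange : LinearMap.range e = LinearMap.ker p := by
    rw [LinearMap.range_comp_of_range_eq_top _ (LinearEquiv.range g), Submodule.range_subtype]
  have hinf : ∀ X ∈ S, ∀ Y ∈ S, X ≠ Y → finrank F (X ⊓ Y : Submodule F (Fin n → F)) ≤ k := by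
    intro X hX Y hY hne
    have := hdist X hX Y hY hne
    rw [subDist, hdim X hX, hdim Y hY] at this
    omega
  have hcomap (X : Submodule F (Fin n → F)) : finrank F (X.comap e) =
      finrank F (X ⊓ LinearMap.ker p : Submodule F (Fin n → F)) := by
    rw [← finrank_map_of_injective he, Submodule.map_comap_eq, hrange, inf_comm]
  have hmeet : ∀ X ∈ S, X ∉ liftedCode F n (2 * k) C → k ≤ finrank F (X.comap e) := by
    intro X hX hXC
    by_contra! hlt
    rw [hcomap] at hlt
    have hrk := finrank_map_add_finrank_inf_ker p X
    rw [hdim X hX] at hrk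
    obtain ⟨A, hA, hAX⟩ := exists_le_finrank_inf_liftSubspace (s := k + 1) (δ := k) hn (by omega) C
      (hC.1.trans (by congr 1; omega)) hC.2 X (show k + 1 ≤ finrank F (X.map p) by omega)
    have := hinf X hX _ (hsub ⟨A, hA, rfl⟩) fun h => hXC ⟨A, hA, h⟩
    omega
  let inside : Set (Submodule F (Fin n → F)) := {X ∈ S | X ≤ LinearMap.range e}
  let mixed : Set (Submodule F (Fin n → F)) :=
    {X ∈ S | X ∉ liftedCode F n (2 * k) C ∧ ¬ X ≤ LinearMap.range e}
  have hcover : S ⊆ liftedCode F n (2 * k) C ∪ mixed ∪ inside := by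
    intro X hX
    simp only [mixed, inside, Set.mem_union, Set.mem_ofPred_eq]
    tauto
  have hlifted : (liftedCode F n (2 * k) C).ncard ≤
      Fintype.card F ^ ((n - 2 * k) * (k + 1)) := by
    refine (ncard_liftedCode_le C).trans_eq ?_
    rw [hC.1]
    congr 2
    omega
  have hinside : inside.ncard ≤ Aq F (n - 2 * k) (2 * k) (2 * k) :=
    ncard_le_Aq_of_le_range he _ (fun X hX => hX.2) (fun X hX => hdim X hX.1)
      fun X hX Y hY => hdist X hX.1 Y hY.1
  have hmixed : mixed.ncard ≤ gaussNat F (n - 2 * k) k *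
      ((Fintype.card F ^ n - Fintype.card F ^ (n - 2 * k)) /
        (Fintype.card F ^ (2 * k) - Fintype.card F ^ k)) := by
    have hmfin : mixed.Finite := hfin.subset fun X hX => hX.1
    have hcount := card_mul_le_of_finrank_inf_le he (k := k) hmfin.toFinset
      (fun X hX => hdim X ((hmfin.mem_toFinset.1 hX).1))
      (fun X hX => hmeet X (hmfin.mem_toFinset.1 hX).1 (hmfin.mem_toFinset.1 hX).2.1)
      (fun X hX => by
        obtain ⟨hXS, -, hXe⟩ := hmfin.mem_toFinset.1 hX
        rw [hcomap]
        exact (Submodule.finrank_lt_finrank_of_lt (inf_le_left.lt_of_ne fun h =>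
          hXe (hrange ▸ inf_eq_left.1 h))).trans_eq (hdim X hXS))
      (fun X hX Y hY => hinf X (hmfin.mem_toFinset.1 hX).1 Y (hmfin.mem_toFinset.1 hY).1)
    rw [← Set.ncard_eq_toFinset_card _ hmfin, Module.finrank_fin_fun, Module.finrank_fin_fun]
      at hcount
    rw [← Nat.mul_div_assoc _ (pow_sub_pow_dvd_pow_sub_pow (by omega)), Nat.le_div_iff_mul_le]
    · exact hcount
    · exact Nat.sub_pos_of_lt (Nat.pow_lt_pow_right Fintype.one_lt_card (by omega))
  calc S.ncard ≤ (liftedCode F n (2 * k) C ∪ mixed ∪ inside).ncard :=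
        Set.ncard_le_ncard hcover (Set.toFinite _)
    _ ≤ (liftedCode F n (2 * k) C).ncard + mixed.ncard + inside.ncard :=
        (Set.ncard_union_le _ _).trans (Nat.add_le_add_right (Set.ncard_union_le _ _) _)
    _ ≤ _ := by gcongr
end
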